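/- Under the stated conditions (exchangeability, feasibility, bounded costs), the MULTIRISK thresholds λ̂_1^{(2)}, …, λ̂_m^{(2)} satisfy all m constraint risks at their nominal levels: for every j ∈ {1,…,m}, E[L_j^{(n+1)}(λ̂_1^{(2)}, …, λ̂_j^{(2)})] ≤ β_j. -/

import Mathlib

open MeasureTheory Set

attribute [local instance] Classical.propDecidable

noncomputable section

/-- The loss `L_j^{(i)}(λ_{1:j}) = V_j^{(i)} · 1{S_1^{(i)} ≤ λ_1, …, S_{j−1}^{(i)} ≤ λ_{j−1},
S_j^{(i)} > λ_j}`.  Only the coordinates `ℓ ≤ j` of the vector `lam` are read. -/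
def lossFn {Ω : Type*} {m n : ℕ} (S V : Fin (n + 1) → Fin m → Ω → ℝ)
    (j : Fin m) (i : Fin (n + 1)) (lam : Fin m → ℝ) (ω : Ω) : ℝ :=
  V i j ω * (if (∀ l, l < j → S i l ω ≤ lam l) ∧ lam j < S i j ω then 1 else 0)

/-- The symmetric oracle risk `g_j^sym(λ_j; λ_{1:(j−1)})`. -/
def gSym {Ω : Type*} {m n : ℕ} (S V : Fin (n + 1) → Fin m → Ω → ℝ)
    (j : Fin m) (lam : Fin m → ℝ) (ω : Ω) : ℝ :=
  (1 / ((n : ℝ) + 1)) * ∑ i : Fin (n + 1), lossFn S V j i lam ω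

/-- The bumped empirical risk `g_j^+(λ_j; λ_{1:(j−1)})`. -/
def gPlus {Ω : Type*} {m n : ℕ} (S V : Fin (n + 1) → Fin m → Ω → ℝ) (Vmax : Fin m → ℝ)
    (j : Fin m) (lam : Fin m → ℝ) (ω : Ω) : ℝ :=
  (1 / ((n : ℝ) + 1)) * ∑ i : Fin n, lossFn S V j i.castSucc lam ω + Vmax j / ((n : ℝ) + 1)

/-- `U_j^sym(λ_{1:(j−1)}; b) = sup{x ∈ Λ_j : g_j^sym(x; λ_{1:(j−1)}) > b}`, the supremum of the
empty set being `λ_j^min` (implemented by inserting `λ_j^min` into the set, which does not change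
the supremum of a nonempty subset of `Λ_j`). -/
def USym {Ω : Type*} {m n : ℕ} (S V : Fin (n + 1) → Fin m → Ω → ℝ)
    (lamMin lamMax : Fin m → ℝ) (j : Fin m) (lam : Fin m → ℝ) (b : ℝ) (ω : Ω) : ℝ :=
  sSup (insert (lamMin j)
    {x | x ∈ Icc (lamMin j) (lamMax j) ∧ b < gSym S V j (Function.update lam j x) ω})

/-- `U_j^+(λ_{1:(j−1)}; b) = inf{x ∈ Λ_j : g_j^+(x; λ_{1:(j−1)}) ≤ b}`, the infimum of the
empty set being `λ_j^max`. -/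
def UPlus {Ω : Type*} {m n : ℕ} (S V : Fin (n + 1) → Fin m → Ω → ℝ) (Vmax : Fin m → ℝ)
    (lamMin lamMax : Fin m → ℝ) (j : Fin m) (lam : Fin m → ℝ) (b : ℝ) (ω : Ω) : ℝ :=
  sInf (insert (lamMax j)
    {x | x ∈ Icc (lamMin j) (lamMax j) ∧ gPlus S V Vmax j (Function.update lam j x) ω ≤ b})

/-- The even-indexed MULTIRISK thresholds: `lamEven … j k = λ̂_j^{(2k)}
= U_j^+(λ̂_1^{(2k+2)},…,λ̂_{j−1}^{(2k+2)}; β_j^{(k−1)})`, with `β_j^{(k)} = β_j − k·δ_j` and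
`δ_j = (Vmax_j − Vmin_j)/(n+1)`.  In particular `lamEven … j 1` is the MULTIRISK threshold
`λ̂_j^{(2)}`. -/
def lamEven {Ω : Type*} {m n : ℕ} (S V : Fin (n + 1) → Fin m → Ω → ℝ)
    (lamMin lamMax Vmin Vmax β : Fin m → ℝ) (j : Fin m) (k : ℕ) (ω : Ω) : ℝ :=
  UPlus S V Vmax lamMin lamMax j
    (fun ℓ => if hl : ℓ < j then lamEven S V lamMin lamMax Vmin Vmax β ℓ (k + 1) ω else 0)
    (β j - ((k : ℝ) - 1) * ((Vmax j - Vmin j) / ((n : ℝ) + 1))) ω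
termination_by j.val
decreasing_by exact hl

abbrev DSp (m n : ℕ) := Fin (n + 1) → (Fin m → ℝ) × (Fin m → ℝ)

def lD {m n : ℕ} (j : Fin m) (i : Fin (n + 1)) (lam : Fin m → ℝ) (d : DSp m n) : ℝ :=
  (d i).2 j * (if (∀ l, l < j → (d i).1 l ≤ lam l) ∧ lam j < (d i).1 j then 1 else 0)

def gD {m n : ℕ} (j : Fin m) (lam : Fin m → ℝ) (d : DSp m n) : ℝ :=
  (1 / ((n : ℝ) + 1)) * ∑ i : Fin (n + 1), lD j i lam d

def UD {m n : ℕ} (lamMin lamMax : Fin m → ℝ) (j : Fin m) (lam : Fin m → ℝ) (b : ℝ)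
    (d : DSp m n) : ℝ :=
  sInf (insert (lamMax j)
    {x | x ∈ Icc (lamMin j) (lamMax j) ∧ gD j (Function.update lam j x) d ≤ b})

def tD {m n : ℕ} (lamMin lamMax Vmin Vmax β : Fin m → ℝ) (j : Fin m) (k : ℕ)
    (d : DSp m n) : ℝ :=
  UD lamMin lamMax j
    (fun l => if hl : l < j then tD lamMin lamMax Vmin Vmax β l (k + 1) d else 0)
    (β j - ((k : ℝ) - 1) * ((Vmax j - Vmin j) / ((n : ℝ) + 1)) - Vmax j / ((n : ℝ) + 1)) d
termination_by j.val
decreasing_by exact hl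

lemma lD_mono {m n : ℕ} (j : Fin m) (i : Fin (n + 1)) (lam lam' : Fin m → ℝ) (d : DSp m n)
    (h0 : 0 ≤ (d i).2 j) (h1 : ∀ l, l < j → lam l ≤ lam' l) (h2 : lam' j ≤ lam j) :
    lD j i lam d ≤ lD j i lam' d := by
  unfold lD
  apply mul_le_mul_of_nonneg_left _ h0
  by_cases h : (∀ l, l < j → (d i).1 l ≤ lam l) ∧ lam j < (d i).1 j
  · have h' : (∀ l, l < j → (d i).1 l ≤ lam' l) ∧ lam' j < (d i).1 j :=
      ⟨fun l hl => (h.1 l hl).trans (h1 l hl), h2.trans_lt h.2⟩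
    rw [if_pos h, if_pos h']
  · rw [if_neg h]; split_ifs <;> norm_num

lemma lD_nonneg {m n : ℕ} (j : Fin m) (i : Fin (n + 1)) (lam : Fin m → ℝ) (d : DSp m n)
    (h0 : 0 ≤ (d i).2 j) : 0 ≤ lD j i lam d := by
  unfold lD
  apply mul_nonneg h0
  split_ifs <;> norm_num

lemma lD_le {m n : ℕ} (j : Fin m) (i : Fin (n + 1)) (lam : Fin m → ℝ) (d : DSp m n)
    (h0 : 0 ≤ (d i).2 j) : lD j i lam d ≤ (d i).2 j := by
  unfold lD
  split_ifs <;> simp [h0]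

lemma gD_right {m n : ℕ} (j : Fin m) (lam : Fin m → ℝ) (d : DSp m n) (u : ℝ) :
    ∃ ε > u, ∀ x, u ≤ x → x < ε →
      gD j (Function.update lam j x) d = gD j (Function.update lam j u) d := by
  have key : ∀ i : Fin (n + 1), ∃ ε > u, ∀ x, u ≤ x → x < ε →
      lD j i (Function.update lam j x) d = lD j i (Function.update lam j u) d := by
    intro i
    have aux : ∀ x, (u < (d i).1 j ↔ x < (d i).1 j) →
        lD j i (Function.update lam j x) d = lD j i (Function.update lam j u) d := by
      intro x hx
      unfold lD
      congr 1
      have : ((∀ l, l < j → (d i).1 l ≤ Function.update lam j x l) ∧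
          Function.update lam j x j < (d i).1 j) ↔
          ((∀ l, l < j → (d i).1 l ≤ Function.update lam j u l) ∧
          Function.update lam j u j < (d i).1 j) := by
        simp only [Function.update_self]
        rw [hx]
        apply and_congr_left
        intro _
        apply forall_congr'
        intro l
        apply imp_congr_right
        intro hl
        rw [Function.update_of_ne hl.ne, Function.update_of_ne hl.ne]
      simp only [this]
    by_cases h : u < (d i).1 j
    · exact ⟨(d i).1 j, h, fun x _ hx2 => aux x ⟨fun _ => hx2, fun _ => h⟩⟩
    · exact ⟨u + 1, by simp, fun x hx _ => aux x
        ⟨fun h' => absurd h' h, fun h' => lt_of_le_of_lt hx h'⟩⟩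
  choose ε hε h using key
  obtain ⟨i0, -, hi0⟩ := Finset.exists_min_image Finset.univ ε ⟨0, Finset.mem_univ 0⟩
  refine ⟨ε i0, hε i0, fun x hx hx2 => ?_⟩
  unfold gD
  congr 1
  exact Finset.sum_congr rfl fun i _ => h i x hx (hx2.trans_le (hi0 i (Finset.mem_univ i)))

lemma UD_bdd {m n : ℕ} (lamMin lamMax : Fin m → ℝ) (hΛ : ∀ j, lamMin j ≤ lamMax j)
    (j : Fin m) (P : ℝ → Prop) :
    BddBelow (insert (lamMax j) {x | x ∈ Icc (lamMin j) (lamMax j) ∧ P x}) := by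
  refine ⟨lamMin j, ?_⟩
  rintro x (rfl | hx)
  · exact hΛ j
  · exact hx.1.1

lemma UD_le_max {m n : ℕ} (lamMin lamMax : Fin m → ℝ) (hΛ : ∀ j, lamMin j ≤ lamMax j)
    (j : Fin m) (lam : Fin m → ℝ) (b : ℝ) (d : DSp m n) :
    UD lamMin lamMax j lam b d ≤ lamMax j :=
  csInf_le (UD_bdd (n := n) lamMin lamMax hΛ j _) (mem_insert _ _)

lemma gD_UD {m n : ℕ} (lamMin lamMax : Fin m → ℝ) (hΛ : ∀ j, lamMin j ≤ lamMax j)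
    (j : Fin m) (lam : Fin m → ℝ) (b : ℝ) (d : DSp m n)
    (hf : gD j (Function.update lam j (lamMax j)) d ≤ b) :
    gD j (Function.update lam j (UD lamMin lamMax j lam b d)) d ≤ b := by
  obtain ⟨ε, hε, h⟩ := gD_right j lam d (UD lamMin lamMax j lam b d)
  obtain ⟨x, hx, hxε⟩ := exists_lt_of_csInf_lt (insert_nonempty _ _) hε
  have hux : UD lamMin lamMax j lam b d ≤ x :=
    csInf_le (UD_bdd (n := n) lamMin lamMax hΛ j _) hx
  rw [← h x hux hxε]
  rcases hx with rfl | hx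
  · exact hf
  · exact hx.2

lemma measurable_lD {m n : ℕ} (j : Fin m) (i : Fin (n + 1)) (lam : DSp m n → Fin m → ℝ)
    (hl : ∀ l, Measurable fun d => lam d l) : Measurable fun d => lD j i (lam d) d := by
  unfold lD
  have hS : ∀ l, Measurable fun d : DSp m n => (d i).1 l := fun l => by fun_prop
  apply Measurable.mul (by fun_prop)
  refine Measurable.ite ?_ measurable_const measurable_const
  apply MeasurableSet.inter
  · have : {d : DSp m n | ∀ l, l < j → (d i).1 l ≤ lam d l}
        = ⋂ l, ⋂ (_ : l < j), {d : DSp m n | (d i).1 l ≤ lam d l} := by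
      ext d; simp
    change MeasurableSet {d : DSp m n | ∀ l, l < j → (d i).1 l ≤ lam d l}
    rw [this]
    exact MeasurableSet.iInter fun l => MeasurableSet.iInter fun _ =>
      measurableSet_le (hS l) (hl l)
  · exact measurableSet_lt (hl j) (hS j)

lemma meas_upd_thr {m n : ℕ} (j : Fin m) (lam : DSp m n → Fin m → ℝ) (u : DSp m n → ℝ)
    (hl : ∀ l, Measurable fun d => lam d l) (hu : Measurable u) (l : Fin m) :
    Measurable fun d => Function.update (lam d) j (u d) l := by
  by_cases h : l = j
  · subst h; simpa using hu
  · simpa [Function.update_of_ne h] using hl l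

lemma measurable_UD {m n : ℕ} (lamMin lamMax : Fin m → ℝ) (hΛ : ∀ j, lamMin j ≤ lamMax j)
    (j : Fin m) (lam : DSp m n → Fin m → ℝ)
    (hl : ∀ l, Measurable fun d => lam d l) (b : ℝ) :
    Measurable fun d => UD lamMin lamMax j (lam d) b d := by
  apply measurable_of_Iio
  intro t
  by_cases ht : lamMax j < t
  · convert MeasurableSet.univ
    ext d
    simpa using (UD_le_max lamMin lamMax hΛ j (lam d) b d).trans_lt ht
  · push Not at ht
    have : (fun d => UD lamMin lamMax j (lam d) b d) ⁻¹' Iio t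
        = ⋃ q : ℚ, ⋃ (_ : (q : ℝ) < t ∧ lamMin j ≤ q),
          {d | gD j (Function.update (lam d) j (q : ℝ)) d ≤ b} ∪
          ⋃ (_ : lamMin j < t), {d | gD j (Function.update (lam d) j (lamMin j)) d ≤ b} := by
      ext d
      simp only [mem_preimage, mem_Iio, mem_iUnion, mem_ofPred_eq, mem_union, exists_prop]
      constructor
      · intro h
        obtain ⟨x, hx, hxt⟩ := exists_lt_of_csInf_lt (insert_nonempty _ _) h
        rcases hx with rfl | hx
        · exact absurd hxt (not_lt.2 ht)
        obtain ⟨ε, hε, he⟩ := gD_right j (lam d) d x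
        obtain ⟨q, hq1, hq2⟩ := exists_rat_btwn (lt_min hε hxt)
        refine ⟨q, ⟨hq2.trans_le (min_le_right _ _), hx.1.1.trans hq1.le⟩, Or.inl ?_⟩
        rw [he q hq1.le (hq2.trans_le (min_le_left _ _))]
        exact hx.2
      · rintro ⟨q, ⟨hq1, hq2⟩, h | h⟩
        · exact (csInf_le (UD_bdd (n := n) lamMin lamMax hΛ j _)
            (mem_insert_of_mem _ ⟨⟨hq2, hq1.le.trans ht⟩, h⟩)).trans_lt hq1
        · exact (csInf_le (UD_bdd (n := n) lamMin lamMax hΛ j _)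
            (mem_insert_of_mem _ ⟨⟨le_rfl, hΛ j⟩, h.2⟩)).trans_lt h.1
    rw [this]
    have hm : ∀ x : ℝ, MeasurableSet {d | gD j (Function.update (lam d) j x) d ≤ b} := by
      intro x
      refine measurableSet_le ?_ measurable_const
      unfold gD
      refine Measurable.const_mul (Finset.measurable_sum _ fun i _ => ?_) _
      exact measurable_lD j i (fun d => Function.update (lam d) j x)
        (meas_upd_thr j lam (fun _ => x) hl measurable_const)
    exact MeasurableSet.iUnion fun q => MeasurableSet.iUnion fun _ =>
      (hm _).union (MeasurableSet.iUnion fun _ => hm _)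

lemma measurable_tD {m n : ℕ} (lamMin lamMax Vmin Vmax β : Fin m → ℝ)
    (hΛ : ∀ j, lamMin j ≤ lamMax j) (j : Fin m) :
    ∀ k, Measurable fun d : DSp m n => tD lamMin lamMax Vmin Vmax β j k d := by
  induction j using WellFoundedLT.induction with
  | ind j ih =>
    intro k
    have : (fun d : DSp m n => tD lamMin lamMax Vmin Vmax β j k d) = fun d =>
        UD lamMin lamMax j
          (fun l => if hl : l < j then tD lamMin lamMax Vmin Vmax β l (k + 1) d else 0)
          (β j - ((k : ℝ) - 1) * ((Vmax j - Vmin j) / ((n : ℝ) + 1))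
            - Vmax j / ((n : ℝ) + 1)) d := by
      funext d; rw [tD]
    rw [this]
    apply measurable_UD lamMin lamMax hΛ j
      (fun d l => if hl : l < j then tD lamMin lamMax Vmin Vmax β l (k + 1) d else 0)
    intro l
    by_cases hl : l < j
    · simpa [hl] using ih l hl (k + 1)
    · simp [hl]

lemma gD_perm {m n : ℕ} (π : Equiv.Perm (Fin (n + 1))) (j : Fin m) (lam : Fin m → ℝ)
    (d : DSp m n) : gD j lam (fun i => d (π i)) = gD j lam d := by
  unfold gD
  congr 1
  exact Equiv.sum_comp π (fun i => lD j i lam d)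

lemma UD_perm {m n : ℕ} (lamMin lamMax : Fin m → ℝ) (π : Equiv.Perm (Fin (n + 1))) (j : Fin m)
    (lam : Fin m → ℝ) (b : ℝ)
    (d : DSp m n) : UD lamMin lamMax j lam b (fun i => d (π i)) = UD lamMin lamMax j lam b d := by
  unfold UD
  simp only [gD_perm]

lemma tD_perm {m n : ℕ} (lamMin lamMax Vmin Vmax β : Fin m → ℝ)
    (π : Equiv.Perm (Fin (n + 1))) (d : DSp m n) (j : Fin m) :
    ∀ k, tD lamMin lamMax Vmin Vmax β j k (fun i => d (π i))
      = tD lamMin lamMax Vmin Vmax β j k d := by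
  induction j using WellFoundedLT.induction with
  | ind j ih =>
    intro k
    rw [tD, tD, UD_perm]
    congr 1
    funext l
    by_cases hl : l < j
    · simp [hl, ih l hl]
    · simp [hl]

lemma tD_le_max {m n : ℕ} (lamMin lamMax Vmin Vmax β : Fin m → ℝ)
    (hΛ : ∀ j, lamMin j ≤ lamMax j) (d : DSp m n) (j : Fin m) (k : ℕ) :
    tD lamMin lamMax Vmin Vmax β j k d ≤ lamMax j := by
  rw [tD]; exact UD_le_max lamMin lamMax hΛ _ _ _ _

/-- the data vector -/
def XD {Ω : Type*} {m n : ℕ} (S V : Fin (n + 1) → Fin m → Ω → ℝ) (ω : Ω) : DSp m n :=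
  fun i => ((fun j => S i j ω), (fun j => V i j ω))

lemma lossFn_eq {Ω : Type*} {m n : ℕ} (S V : Fin (n + 1) → Fin m → Ω → ℝ)
    (j : Fin m) (i : Fin (n + 1)) (lam : Fin m → ℝ) (ω : Ω) :
    lossFn S V j i lam ω = lD j i lam (XD S V ω) := rfl

lemma gPlus_eq {Ω : Type*} {m n : ℕ} (S V : Fin (n + 1) → Fin m → Ω → ℝ) (Vmax : Fin m → ℝ)
    (j : Fin m) (lam : Fin m → ℝ) (ω : Ω) :
    gPlus S V Vmax j lam ω = gD j lam (XD S V ω)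
      + (Vmax j - lD j (Fin.last n) lam (XD S V ω)) / ((n : ℝ) + 1) := by
  unfold gPlus gD
  rw [Fin.sum_univ_castSucc]
  simp only [lossFn_eq]
  ring

lemma gPlus_mono {Ω : Type*} {m n : ℕ} (S V : Fin (n + 1) → Fin m → Ω → ℝ) (Vmax : Fin m → ℝ)
    (j : Fin m) (lam lam' : Fin m → ℝ) (ω : Ω) (h0 : ∀ i j, 0 ≤ V i j ω)
    (h1 : ∀ l, l < j → lam l ≤ lam' l) (h2 : lam' j ≤ lam j) :
    gPlus S V Vmax j lam ω ≤ gPlus S V Vmax j lam' ω := by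
  unfold gPlus
  gcongr with i _
  exact lD_mono j i.castSucc lam lam' (XD S V ω) (h0 _ _) h1 h2

lemma lamEven_mono {Ω : Type*} {m n : ℕ} (S V : Fin (n + 1) → Fin m → Ω → ℝ)
    (lamMin lamMax Vmin Vmax β : Fin m → ℝ) (hΛ : ∀ j, lamMin j ≤ lamMax j)
    (hVle : ∀ j, Vmin j ≤ Vmax j) (ω : Ω) (h0 : ∀ i j, 0 ≤ V i j ω) (j : Fin m) :
    ∀ k, lamEven S V lamMin lamMax Vmin Vmax β j k ω
      ≤ lamEven S V lamMin lamMax Vmin Vmax β j (k + 1) ω := by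
  induction j using WellFoundedLT.induction with
  | ind j ih =>
    intro k
    rw [lamEven, lamEven]
    unfold UPlus
    apply csInf_le_csInf (UD_bdd (n := n) lamMin lamMax hΛ j _) (insert_nonempty _ _)
    apply insert_subset_insert
    rintro x ⟨hx, hg⟩
    refine ⟨hx, le_trans (gPlus_mono S V Vmax j _ _ ω h0 ?_ (by simp)) (hg.trans ?_)⟩
    · intro l hl
      simpa [Function.update_of_ne hl.ne, hl] using ih l hl (k + 1)
    · have : 0 ≤ (Vmax j - Vmin j) / ((n : ℝ) + 1) :=
        div_nonneg (sub_nonneg.2 (hVle j)) (by positivity)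
      push_cast
      nlinarith

lemma lamEven_eq_tD {Ω : Type*} {m n : ℕ} (S V : Fin (n + 1) → Fin m → Ω → ℝ)
    (lamMin lamMax Vmin Vmax β : Fin m → ℝ) (hΛ : ∀ j, lamMin j ≤ lamMax j)
    (hVle : ∀ j, Vmin j ≤ Vmax j) (ω : Ω) (h0 : ∀ i j, 0 ≤ V i j ω) (j : Fin m) :
    (∀ l, l ≤ j → S (Fin.last n) l ω ≤ lamEven S V lamMin lamMax Vmin Vmax β l 1 ω) →
    ∀ k, lamEven S V lamMin lamMax Vmin Vmax β j (k + 1) ω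
      = tD lamMin lamMax Vmin Vmax β j (k + 1) (XD S V ω) := by
  induction j using WellFoundedLT.induction with
  | ind j ih =>
    intro hS k
    have hmono : lamEven S V lamMin lamMax Vmin Vmax β j 1 ω
        ≤ lamEven S V lamMin lamMax Vmin Vmax β j (k + 1) ω := by
      have := monotone_nat_of_le_succ (f := fun k => lamEven S V lamMin lamMax Vmin Vmax β j k ω)
        (lamEven_mono S V lamMin lamMax Vmin Vmax β hΛ hVle ω h0 j)
      exact this (by omega)
    have hs := (hS j le_rfl).trans hmono
    rw [lamEven] at hs ⊢
    rw [tD]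
    have hlam : (fun l => if hl : l < j then
          lamEven S V lamMin lamMax Vmin Vmax β l (k + 1 + 1) ω else 0)
        = (fun l => if hl : l < j then
          tD lamMin lamMax Vmin Vmax β l (k + 1 + 1) (XD S V ω) else 0) := by
      funext l
      by_cases hl : l < j
      · simp only [hl, dif_pos]
        exact ih l hl (fun l' hl' => hS l' (hl'.trans hl.le)) (k + 1)
      · simp [hl]
    rw [hlam] at hs ⊢
    generalize (fun l => if hl : l < j then
          tD lamMin lamMax Vmin Vmax β l (k + 1 + 1) (XD S V ω) else 0) = lam at hs ⊢
    generalize β j - (((k + 1 : ℕ) : ℝ) - 1) * ((Vmax j - Vmin j) / ((n : ℝ) + 1)) = b at hs ⊢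
    have hpos : (0 : ℝ) < (n : ℝ) + 1 := by positivity
    unfold UPlus at hs ⊢
    unfold UD
    congr 2
    ext x
    simp only [mem_ofPred_eq]
    apply and_congr_right
    intro hx
    rw [gPlus_eq]
    constructor
    · intro hg
      have hsx : S (Fin.last n) j ω ≤ x := hs.trans
        (csInf_le (UD_bdd (n := n) lamMin lamMax hΛ j _)
          (mem_insert_of_mem _ ⟨hx, by rw [gPlus_eq]; exact hg⟩))
      have hz : lD j (Fin.last n) (Function.update lam j x) (XD S V ω) = 0 := by
        unfold lD
        rw [if_neg, mul_zero]
        rintro ⟨-, h⟩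
        rw [Function.update_self] at h
        exact absurd h (not_lt.2 hsx)
      rw [hz, sub_zero] at hg
      linarith
    · intro hg
      have : 0 ≤ lD j (Fin.last n) (Function.update lam j x) (XD S V ω) :=
        lD_nonneg _ _ _ _ (h0 _ _)
      rw [sub_div]
      have := div_nonneg this hpos.le
      linarith

/-- symmetric final threshold vector -/
def fin_thr {m n : ℕ} (lamMin lamMax Vmin Vmax β : Fin m → ℝ) (j : Fin m)
    (d : DSp m n) : Fin m → ℝ :=
  Function.update (fun l => if l < j then tD lamMin lamMax Vmin Vmax β l 2 d else 0) j
    (UD lamMin lamMax j (fun l => if l < j then tD lamMin lamMax Vmin Vmax β l 2 d else 0) (β j) d)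

lemma fin_thr_perm {m n : ℕ} (lamMin lamMax Vmin Vmax β : Fin m → ℝ) (j : Fin m)
    (π : Equiv.Perm (Fin (n + 1))) (d : DSp m n) :
    fin_thr lamMin lamMax Vmin Vmax β j (fun i => d (π i))
      = fin_thr lamMin lamMax Vmin Vmax β j d := by
  unfold fin_thr
  simp only [tD_perm, UD_perm]

lemma measurable_fin_thr {m n : ℕ} (lamMin lamMax Vmin Vmax β : Fin m → ℝ)
    (hΛ : ∀ j, lamMin j ≤ lamMax j) (j l : Fin m) :
    Measurable fun d : DSp m n => fin_thr lamMin lamMax Vmin Vmax β j d l := by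
  have h : ∀ l, Measurable fun d : DSp m n =>
      (if l < j then tD lamMin lamMax Vmin Vmax β l 2 d else 0) := by
    intro l
    by_cases hl : l < j
    · simpa [hl] using measurable_tD lamMin lamMax Vmin Vmax β hΛ l 2
    · simp [hl]
  exact meas_upd_thr j
    (fun d l => if l < j then tD lamMin lamMax Vmin Vmax β l 2 d else 0) _ h
    (measurable_UD lamMin lamMax hΛ j
      (fun d l => if l < j then tD lamMin lamMax Vmin Vmax β l 2 d else 0) h _) l

lemma loss_le {Ω : Type*} {m n : ℕ} (S V : Fin (n + 1) → Fin m → Ω → ℝ)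
    (lamMin lamMax Vmin Vmax β : Fin m → ℝ) (hΛ : ∀ j, lamMin j ≤ lamMax j)
    (hVle : ∀ j, Vmin j ≤ Vmax j) (ω : Ω) (h0 : ∀ i j, 0 ≤ V i j ω)
    (h1 : ∀ i j, V i j ω ≤ Vmax j) (j : Fin m) :
    lossFn S V j (Fin.last n) (fun l => lamEven S V lamMin lamMax Vmin Vmax β l 1 ω) ω
      ≤ lD j (Fin.last n) (fin_thr lamMin lamMax Vmin Vmax β j (XD S V ω)) (XD S V ω) := by
  by_cases hS : ∀ l, l < j → S (Fin.last n) l ω ≤ lamEven S V lamMin lamMax Vmin Vmax β l 1 ω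
  · have heq : ∀ l, l < j → lamEven S V lamMin lamMax Vmin Vmax β l 2 ω
        = tD lamMin lamMax Vmin Vmax β l 2 (XD S V ω) := fun l hl =>
      lamEven_eq_tD S V lamMin lamMax Vmin Vmax β hΛ hVle ω h0 l
        (fun l' hl' => hS l' (hl'.trans_lt hl)) 1
    rw [lossFn_eq]
    apply lD_mono _ _ _ _ _ (h0 _ _)
    · intro l hl
      rw [fin_thr, Function.update_of_ne hl.ne, if_pos hl, ← heq l hl]
      exact lamEven_mono S V lamMin lamMax Vmin Vmax β hΛ hVle ω h0 l 1
    · rw [fin_thr, Function.update_self, lamEven]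
      have hlam : (fun l => if hl : l < j then
          lamEven S V lamMin lamMax Vmin Vmax β l (1 + 1) ω else 0)
          = (fun l => if l < j then
          tD lamMin lamMax Vmin Vmax β l 2 (XD S V ω) else 0) := by
        funext l
        by_cases hl : l < j
        · simp only [hl, dif_pos, if_pos]
          exact heq l hl
        · simp [hl]
      rw [hlam]
      unfold UD UPlus
      apply csInf_le_csInf (UD_bdd (n := n) lamMin lamMax hΛ j _) (insert_nonempty _ _)
      apply insert_subset_insert
      rintro x ⟨hx, hg⟩
      refine ⟨hx, ?_⟩
      rw [gPlus_eq] at hg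
      have h2 := (lD_le j (Fin.last n) (Function.update (fun l => if l < j then
          tD lamMin lamMax Vmin Vmax β l 2 (XD S V ω) else 0) j x) (XD S V ω)
          (h0 _ _)).trans (h1 _ _)
      have h3 := div_nonneg (sub_nonneg.2 h2) (by positivity : (0 : ℝ) ≤ (n : ℝ) + 1)
      simp only [Nat.cast_one, sub_self, zero_mul, sub_zero] at hg
      linarith
  · have : lossFn S V j (Fin.last n) (fun l => lamEven S V lamMin lamMax Vmin Vmax β l 1 ω) ω
        = 0 := by
      unfold lossFn
      rw [if_neg (fun h => hS h.1), mul_zero]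
    rw [this]
    exact lD_nonneg _ _ _ _ (h0 _ _)

lemma gD_fin {m n : ℕ} (lamMin lamMax Vmin Vmax β : Fin m → ℝ)
    (hΛ : ∀ j, lamMin j ≤ lamMax j) (j : Fin m) (d : DSp m n) (h0 : ∀ i, 0 ≤ (d i).2 j)
    (hf : ∀ i, lD j i lamMax d ≤ β j) :
    gD j (fin_thr lamMin lamMax Vmin Vmax β j d) d ≤ β j := by
  apply gD_UD lamMin lamMax hΛ
  have hpos : (0 : ℝ) < (n : ℝ) + 1 := by positivity
  have : ∑ i : Fin (n + 1), lD j i (Function.update (fun l => if l < j then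
      tD lamMin lamMax Vmin Vmax β l 2 d else 0) j (lamMax j)) d ≤ ∑ i : Fin (n + 1), β j := by
    apply Finset.sum_le_sum
    intro i _
    refine le_trans (lD_mono j i _ lamMax d (h0 i) ?_ (by simp)) (hf i)
    intro l hl
    rw [Function.update_of_ne hl.ne, if_pos hl]
    exact tD_le_max lamMin lamMax Vmin Vmax β hΛ d l 2
  unfold gD
  rw [one_div, inv_mul_le_iff₀ hpos]
  simpa using this

/-- Theorem: upper bound on MULTIRISK constraint risks.  Under exchangeability,
feasibility and bounded costs, the MULTIRISK thresholds `λ̂_1^{(2)}, …, λ̂_m^{(2)}` control every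
constraint risk: for each `j`, `E[L_j^{(n+1)}(λ̂_1^{(2)},…,λ̂_j^{(2)})] ≤ β_j`. -/
theorem multirisk_risk_control
    {Ω : Type*} [MeasurableSpace Ω] (μ : Measure Ω) [IsProbabilityMeasure μ]
    (m n : ℕ) (hm : 1 ≤ m) (hn : 1 ≤ n)
    (S V : Fin (n + 1) → Fin m → Ω → ℝ)
    (hSmeas : ∀ i j, Measurable (S i j)) (hVmeas : ∀ i j, Measurable (V i j))
    (lamMin lamMax : Fin m → ℝ) (hΛ : ∀ j, lamMin j ≤ lamMax j)
    (β : Fin m → ℝ) (hβ : ∀ j, 0 ≤ β j)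
    (Vmin Vmax : Fin m → ℝ) (hVmin0 : ∀ j, 0 ≤ Vmin j) (hVle : ∀ j, Vmin j ≤ Vmax j)
    -- bounded costs
    (hVbd : ∀ i j, ∀ᵐ ω ∂μ, V i j ω ∈ Icc (Vmin j) (Vmax j))
    -- exchangeability
    (hexch : ∀ π : Equiv.Perm (Fin (n + 1)),
      Measure.map (fun ω => fun i : Fin (n + 1) =>
          ((fun j => S (π i) j ω), (fun j => V (π i) j ω))) μ
        = Measure.map (fun ω => fun i : Fin (n + 1) =>
          ((fun j => S i j ω), (fun j => V i j ω))) μ)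
    -- feasibility
    (hfeas : ∀ (j : Fin m) (i : Fin (n + 1)), ∀ᵐ ω ∂μ, lossFn S V j i lamMax ω ≤ β j) :
    ∀ j : Fin m,
      ∫ ω, lossFn S V j (Fin.last n)
          (fun ℓ => lamEven S V lamMin lamMax Vmin Vmax β ℓ 1 ω) ω ∂μ ≤ β j := by
  intro j
  have hpos : (0 : ℝ) < (n : ℝ) + 1 := by positivity
  have hbd : ∀ᵐ ω ∂μ, ∀ i j, V i j ω ∈ Icc (Vmin j) (Vmax j) := by
    rw [ae_all_iff]; intro i; rw [ae_all_iff]; intro j; exact hVbd i j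
  have hfe : ∀ᵐ ω ∂μ, ∀ i, lossFn S V j i lamMax ω ≤ β j := by
    rw [ae_all_iff]; exact hfeas j
  have hX : Measurable (XD S V) := by
    unfold XD
    refine measurable_pi_lambda _ fun i => Measurable.prodMk ?_ ?_
    · exact measurable_pi_lambda _ fun j => hSmeas i j
    · exact measurable_pi_lambda _ fun j => hVmeas i j
  let F : Fin (n + 1) → DSp m n → ℝ := fun i d =>
    lD j i (fin_thr lamMin lamMax Vmin Vmax β j d) d
  have hF : ∀ i, Measurable (F i) := fun i => measurable_lD j i _
    (measurable_fin_thr lamMin lamMax Vmin Vmax β hΛ j)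
  have hint : ∀ i, Integrable (fun ω => F i (XD S V ω)) μ := by
    intro i
    refine Integrable.of_bound ((hF i).comp hX).aestronglyMeasurable (Vmax j) ?_
    filter_upwards [hbd] with ω hω
    have h0 : 0 ≤ V i j ω := (hVmin0 j).trans (hω i j).1
    rw [Real.norm_of_nonneg (lD_nonneg _ _ _ _ h0)]
    exact (lD_le _ _ _ _ h0).trans (hω i j).2
  have hsymm : ∀ i, ∫ ω, F i (XD S V ω) ∂μ = ∫ ω, F (Fin.last n) (XD S V ω) ∂μ := by
    intro i
    let π : Equiv.Perm (Fin (n + 1)) := Equiv.swap (Fin.last n) i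
    have hπ : Measurable fun d : DSp m n => (fun i => d (π i) : DSp m n) := by fun_prop
    have hX2 : Measurable fun ω => (fun i => XD S V ω (π i) : DSp m n) := hπ.comp hX
    have e1 := integral_map (μ := μ) hX2.aemeasurable
      (f := F (Fin.last n)) (hF _).aestronglyMeasurable
    have e2 := integral_map (μ := μ) hX.aemeasurable
      (f := F (Fin.last n)) (hF _).aestronglyMeasurable
    have e3 : Measure.map (fun ω => (fun i => XD S V ω (π i) : DSp m n)) μ
        = Measure.map (XD S V) μ := hexch π
    rw [e3, e2] at e1
    rw [e1]
    congr 1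
    funext ω
    change _ = lD j (Fin.last n) (fin_thr lamMin lamMax Vmin Vmax β j
      (fun i => XD S V ω (π i))) (fun i => XD S V ω (π i))
    rw [fin_thr_perm]
    have : π (Fin.last n) = i := Equiv.swap_apply_left _ _
    simp only [F, lD, this]
  have hle : ∫ ω, lossFn S V j (Fin.last n)
      (fun ℓ => lamEven S V lamMin lamMax Vmin Vmax β ℓ 1 ω) ω ∂μ
      ≤ ∫ ω, F (Fin.last n) (XD S V ω) ∂μ := by
    apply integral_mono_of_nonneg _ (hint _)
    · filter_upwards [hbd] with ω hω
      exact loss_le S V lamMin lamMax Vmin Vmax β hΛ hVle ω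
        (fun i j => (hVmin0 j).trans (hω i j).1) (fun i j => (hω i j).2) j
    · filter_upwards [hbd] with ω hω
      exact lD_nonneg _ _ _ (XD S V ω) ((hVmin0 j).trans (hω _ j).1)
  refine hle.trans ?_
  have hsum : ∫ ω, gD j (fin_thr lamMin lamMax Vmin Vmax β j (XD S V ω)) (XD S V ω) ∂μ
      = ∫ ω, F (Fin.last n) (XD S V ω) ∂μ := by
    unfold gD
    rw [integral_const_mul]
    have : ∫ ω, ∑ i, F i (XD S V ω) ∂μ = ∑ i, ∫ ω, F i (XD S V ω) ∂μ :=
      integral_finsetSum _ fun i _ => hint i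
    change _ * ∫ ω, ∑ i, F i (XD S V ω) ∂μ = _
    rw [this, Finset.sum_congr rfl fun i _ => hsymm i]
    simp only [Finset.sum_const, Finset.card_univ, Fintype.card_fin, nsmul_eq_mul]
    push_cast
    field_simp
  rw [← hsum]
  have hgint : Integrable (fun ω =>
      gD j (fin_thr lamMin lamMax Vmin Vmax β j (XD S V ω)) (XD S V ω)) μ := by
    unfold gD
    exact (integrable_finsetSum _ fun i _ => hint i).const_mul _
  have := integral_mono_ae hgint (integrable_const (β j)) (by
    filter_upwards [hbd, hfe] with ω hω hf
    exact gD_fin lamMin lamMax Vmin Vmax β hΛ j (XD S V ω)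
      (fun i => (hVmin0 j).trans (hω i j).1) hf)
  simpa using this

end
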